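/- Let ρ be a normalized state on registers A, B, C, let σ_C be positive semidefinite on C, and let ω'_A, ω''_B be normalized states on A and B; let α ∈ (0,1)∪(1,∞). Define ν_AC = (ρ_AC^{1/2}(ω'_A⊗σ_C)^{(1−α)/α}ρ_AC^{1/2})^α / Tr[(ρ_AC^{1/2}(ω'_A⊗σ_C)^{(1−α)/α}ρ_AC^{1/2})^α] and ν_ABC = ν_AC^{1/2}·ρ_{B|AC}·ν_AC^{1/2}. Then (i) inf over normalized states ω_AB on AB of D_α(ρ_ABC‖ω_AB⊗σ_C) ≤ D_α(ρ_AC‖ω'_A⊗σ_C) + D_α(ν_ABC‖ω''_B⊗ν_AC); and (ii) choosing σ_C = ρ_C and choosing ω'_A and ω''_B as the optimizers of the respective infima, one obtains I_α↓(C;AB)_ρ ≤ I_α↓(C;A)_ρ + I_α↓(AC;B)_ν. -/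

import Mathlib

open scoped Kronecker
open Matrix
open scoped ComplexOrder

noncomputable section
namespace QITLeak

variable {A B : Type*}

/-- Real matrix power via spectral decomposition (Moore–Penrose pseudoinverse powers,
since `(0:ℝ) ^ (p:ℝ) = 0` for `p ≠ 0`). Junk value `0` on non-Hermitian input. -/
noncomputable def mpow [Fintype A] [DecidableEq A] (ρ : Matrix A A ℂ) (p : ℝ) :
    Matrix A A ℂ :=
  if hρ : ρ.IsHermitian then
    (hρ.eigenvectorUnitary : Matrix A A ℂ) *
      Matrix.diagonal (fun i => ((hρ.eigenvalues i ^ p : ℝ) : ℂ)) *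
      (star (hρ.eigenvectorUnitary : Matrix A A ℂ))
  else 0

/-- A normalized state (density matrix). -/
def IsState [Fintype A] (ρ : Matrix A A ℂ) : Prop := ρ.PosSemidef ∧ ρ.trace = 1

/-- A subnormalized state. -/
def IsSubState [Fintype A] (ρ : Matrix A A ℂ) : Prop := ρ.PosSemidef ∧ (ρ.trace).re ≤ 1

/-- Partial trace over the second tensor factor. -/
def ptB [Fintype B] (ρ : Matrix (A × B) (A × B) ℂ) : Matrix A A ℂ :=
  Matrix.of fun a a' => ∑ b, ρ (a, b) (a', b)

/-- Partial trace over the first tensor factor. -/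
def ptA [Fintype A] (ρ : Matrix (A × B) (A × B) ℂ) : Matrix B B ℂ :=
  Matrix.of fun b b' => ∑ a, ρ (a, b) (a, b')

/-- Partial trace over the factor `B`, along a decomposition `X ≃ A × B` of the registers. -/
def traceOut {X A B : Type*} [Fintype B] (e : X ≃ A × B) (ρ : Matrix X X ℂ) :
    Matrix A A ℂ :=
  Matrix.of fun a a' => ∑ b, ρ (e.symm (a, b)) (e.symm (a', b))

/-- Support inclusion `supp ρ ⊆ supp σ` (for PSD matrices: kernel inclusion). -/
def suppSubset [Fintype A] (ρ σ : Matrix A A ℂ) : Prop :=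
  ∀ v : A → ℂ, σ *ᵥ v = 0 → ρ *ᵥ v = 0

/-- The real-valued core formula of the sandwiched Rényi divergence (base 2). -/
def DR (α : ℝ) [Fintype A] [DecidableEq A] (ρ σ : Matrix A A ℂ) : ℝ :=
  (α - 1)⁻¹ * Real.logb 2
    (((mpow (mpow σ ((1 - α) / (2 * α)) * ρ * mpow σ ((1 - α) / (2 * α))) α).trace.re)
      / (ρ.trace).re)

open scoped Classical in
/-- The sandwiched Rényi divergence `D_α(ρ‖σ)`, with value `⊤` outside the
support/orthogonality conditions. -/
def D (α : ℝ) [Fintype A] [DecidableEq A] (ρ σ : Matrix A A ℂ) : EReal :=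
  if (α < 1 ∧ ¬ (ρ * σ = 0 ∧ σ * ρ = 0)) ∨ suppSubset ρ σ then ((DR α ρ σ : ℝ) : EReal)
  else ⊤

/-- The max-divergence `D_∞(ρ‖σ)`: log of the least `μ ≥ 0` with `ρ ≤ μσ` (`⊤` if none). -/
def Dmax [Fintype A] (ρ σ : Matrix A A ℂ) : EReal :=
  sInf {x : EReal | ∃ μ : ℝ, 0 ≤ μ ∧ (μ • σ - ρ).PosSemidef ∧ x = ((Real.logb 2 μ : ℝ) : EReal)}

section Ent
variable [Fintype A] [DecidableEq A] [Fintype B] [DecidableEq B]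

/-- `H_α↑(A|B)_ρ` for `ρ` on `A × B`. -/
def HUp (α : ℝ) (ρ : Matrix (A × B) (A × B) ℂ) : EReal :=
  - sInf {x : EReal | ∃ σ : Matrix B B ℂ, IsState σ ∧ x = D α ρ ((1 : Matrix A A ℂ) ⊗ₖ σ)}

/-- `H_α(A|B)_ρ` for `ρ` on `A × B`. -/
def Hdn (α : ℝ) (ρ : Matrix (A × B) (A × B) ℂ) : EReal :=
  - D α ρ ((1 : Matrix A A ℂ) ⊗ₖ ptA ρ)

/-- `I_α↓(A;B)_ρ` for `ρ` on `A × B`. -/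
def Idown (α : ℝ) (ρ : Matrix (A × B) (A × B) ℂ) : EReal :=
  sInf {x : EReal | ∃ σ : Matrix B B ℂ, IsState σ ∧ x = D α ρ ((ptB ρ) ⊗ₖ σ)}

/-- `I_α(A:B)_ρ` for `ρ` on `A × B`. -/
def Imut (α : ℝ) (ρ : Matrix (A × B) (A × B) ℂ) : EReal :=
  D α ρ ((ptB ρ) ⊗ₖ (ptA ρ))

/-- `I_α↓↓(A:B)_ρ` for `ρ` on `A × B`. -/
def Idd (α : ℝ) (ρ : Matrix (A × B) (A × B) ℂ) : EReal :=
  sInf {x : EReal | ∃ (ω : Matrix A A ℂ) (σ : Matrix B B ℂ),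
    IsState ω ∧ IsState σ ∧ x = D α ρ (ω ⊗ₖ σ)}

/-- `H_min↑(A|B)_ρ = H_∞↑(A|B)_ρ`. -/
def HminUp (ρ : Matrix (A × B) (A × B) ℂ) : EReal :=
  - sInf {x : EReal | ∃ σ : Matrix B B ℂ, IsState σ ∧ x = Dmax ρ ((1 : Matrix A A ℂ) ⊗ₖ σ)}

/-- `I_∞↓(A;B)_ρ`. -/
def ImaxD (ρ : Matrix (A × B) (A × B) ℂ) : EReal :=
  sInf {x : EReal | ∃ σ : Matrix B B ℂ, IsState σ ∧ x = Dmax ρ ((ptB ρ) ⊗ₖ σ)}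

/-- `I_∞(A:B)_ρ` (unoptimized max-information). -/
def ImaxND (ρ : Matrix (A × B) (A × B) ℂ) : EReal :=
  Dmax ρ ((ptB ρ) ⊗ₖ (ptA ρ))

/-- `I_∞↓↓(A:B)_ρ`. -/
def IddMax (ρ : Matrix (A × B) (A × B) ℂ) : EReal :=
  sInf {x : EReal | ∃ (ω : Matrix A A ℂ) (σ : Matrix B B ℂ),
    IsState ω ∧ IsState σ ∧ x = Dmax ρ (ω ⊗ₖ σ)}

end Ent

/-- Trace norm. -/
def traceNorm [Fintype A] [DecidableEq A] (M : Matrix A A ℂ) : ℝ :=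
  (mpow (Mᴴ * M) (1 / 2 : ℝ)).trace.re

/-- Generalized fidelity of subnormalized states. -/
def gFid [Fintype A] [DecidableEq A] (ρ σ : Matrix A A ℂ) : ℝ :=
  traceNorm (mpow ρ (1 / 2 : ℝ) * mpow σ (1 / 2 : ℝ)) +
    Real.sqrt ((1 - ρ.trace.re) * (1 - σ.trace.re))

/-- Purified distance. -/
def pDist [Fintype A] [DecidableEq A] (ρ σ : Matrix A A ℂ) : ℝ :=
  Real.sqrt (1 - gFid ρ σ ^ 2)

section Smooth
variable [Fintype A] [DecidableEq A] [Fintype B] [DecidableEq B]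

/-- Smoothed min-entropy `H_min↑,ε(A|B)_ρ`. -/
def HminUpEps (ε : ℝ) (ρ : Matrix (A × B) (A × B) ℂ) : EReal :=
  sSup {x : EReal | ∃ ρ' : Matrix (A × B) (A × B) ℂ,
    IsSubState ρ' ∧ pDist ρ' ρ ≤ ε ∧ x = HminUp ρ'}

/-- Smoothed max-information `I_max↓,ε(A;B)_ρ`. -/
def ImaxDEps (ε : ℝ) (ρ : Matrix (A × B) (A × B) ℂ) : EReal :=
  sInf {x : EReal | ∃ ρ' : Matrix (A × B) (A × B) ℂ,
    IsSubState ρ' ∧ pDist ρ' ρ ≤ ε ∧ x = ImaxD ρ'}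

/-- Smoothed (unoptimized) max-information `I_max^ε(A:B)_ρ`. -/
def ImaxNDEps (ε : ℝ) (ρ : Matrix (A × B) (A × B) ℂ) : EReal :=
  sInf {x : EReal | ∃ ρ' : Matrix (A × B) (A × B) ℂ,
    IsSubState ρ' ∧ pDist ρ' ρ ≤ ε ∧ x = ImaxND ρ'}

/-- Smoothed max-information `I_max↓↓,ε(A:B)_ρ`. -/
def IddMaxEps (ε : ℝ) (ρ : Matrix (A × B) (A × B) ℂ) : EReal :=
  sInf {x : EReal | ∃ ρ' : Matrix (A × B) (A × B) ℂ,
    IsSubState ρ' ∧ pDist ρ' ρ ≤ ε ∧ x = IddMax ρ'}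

/-- Smoothed Rényi conditional entropy `H_α↑,ε(A|B)_ρ`. -/
def HUpEps (α ε : ℝ) (ρ : Matrix (A × B) (A × B) ℂ) : EReal :=
  sSup {x : EReal | ∃ ρ' : Matrix (A × B) (A × B) ℂ,
    IsSubState ρ' ∧ pDist ρ' ρ ≤ ε ∧ x = HUp α ρ'}

end Smooth

/-- Extension `id_R ⊗ Φ` of a linear map on matrices, with a spectator register on the left. -/
def lext {R A B : Type*} (Φ : Matrix A A ℂ →ₗ[ℂ] Matrix B B ℂ) :
    Matrix (R × A) (R × A) ℂ →ₗ[ℂ] Matrix (R × B) (R × B) ℂ where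
  toFun ρ := Matrix.of fun p q => Φ (Matrix.of fun a a' => ρ (p.1, a) (q.1, a')) p.2 q.2
  map_add' x y := by
    ext p q
    show Φ ((Matrix.of fun a a' => x (p.1, a) (q.1, a'))
        + (Matrix.of fun a a' => y (p.1, a) (q.1, a'))) p.2 q.2 = _
    rw [map_add]; rfl
  map_smul' c x := by
    ext p q
    show Φ (c • (Matrix.of fun a a' => x (p.1, a) (q.1, a'))) p.2 q.2 = _
    rw [_root_.map_smul]; rfl

/-- Extension `Φ ⊗ id_R` of a linear map on matrices, with a spectator register on the right. -/
def rext {A B R : Type*} (Φ : Matrix A A ℂ →ₗ[ℂ] Matrix B B ℂ) :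
    Matrix (A × R) (A × R) ℂ →ₗ[ℂ] Matrix (B × R) (B × R) ℂ where
  toFun ρ := Matrix.of fun p q => Φ (Matrix.of fun a a' => ρ (a, p.2) (a', q.2)) p.1 q.1
  map_add' x y := by
    ext p q
    show Φ ((Matrix.of fun a a' => x (a, p.2) (a', q.2))
        + (Matrix.of fun a a' => y (a, p.2) (a', q.2))) p.1 q.1 = _
    rw [map_add]; rfl
  map_smul' c x := by
    ext p q
    show Φ (c • (Matrix.of fun a a' => x (a, p.2) (a', q.2))) p.1 q.1 = _
    rw [_root_.map_smul]; rfl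

/-- Completely positive trace-preserving map (quantum channel). -/
structure IsCPTP {A B : Type*} [Fintype A] [Fintype B]
    (Φ : Matrix A A ℂ →ₗ[ℂ] Matrix B B ℂ) : Prop where
  cp : ∀ (n : ℕ) (ρ : Matrix (Fin n × A) (Fin n × A) ℂ), ρ.PosSemidef →
    ((lext Φ) ρ).PosSemidef
  tp : ∀ ρ : Matrix A A ℂ, (Φ ρ).trace = ρ.trace

/-- The rank-one (pure) state associated to a vector. -/
def pureState {A : Type*} (ψ : A → ℂ) : Matrix A A ℂ := Matrix.vecMulVec ψ (star ψ)


/-! ## Statement 5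
Chain-rule inequality for Rényi divergences and the resulting chain rule
`I_α↓(C;AB)_ρ ≤ I_α↓(C;A)_ρ + I_α↓(AC;B)_ν`.
The tripartite state is arranged on `(A × C) × B`. -/

/-- Register shuffle `(A × B) × C ≃ (A × C) × B`. -/
def eACB (A B C : Type*) : (A × B) × C ≃ (A × C) × B where
  toFun x := ((x.1.1, x.2), x.1.2)
  invFun y := ((y.1.1, y.2), y.1.2)
  left_inv _ := rfl
  right_inv _ := rfl

/-- Register shuffle `(A × C) × B ≃ C × (A × B)`. -/
def eCAB (A B C : Type*) : (A × C) × B ≃ C × (A × B) where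
  toFun x := (x.1.2, (x.1.1, x.2))
  invFun y := ((y.2.1, y.1), y.2.2)
  left_inv _ := rfl
  right_inv _ := rfl

section Power

variable {n m : Type*} [Fintype n] [DecidableEq n] [Fintype m] [DecidableEq m]

/-- Powers can be computed in any unitary diagonalization. -/
lemma mpow_eq_of_unitary_diagonal {M V : Matrix n n ℂ} (hV : Vᴴ * V = 1) (d : n → ℝ)
    (hM : M = V * diagonal (fun i => (d i : ℂ)) * Vᴴ) (p : ℝ) :
    mpow M p = V * diagonal (fun i => ((d i ^ p : ℝ) : ℂ)) * Vᴴ := by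
  have hV' : V * Vᴴ = 1 := mul_eq_one_comm.mp hV
  have hH : M.IsHermitian := by
    rw [hM, IsHermitian, conjTranspose_mul, conjTranspose_mul, conjTranspose_conjTranspose,
      diagonal_conjTranspose, mul_assoc]
    congr 3
    ext i
    simp
  set U : Matrix n n ℂ := (hH.eigenvectorUnitary : Matrix n n ℂ) with hU
  have hUU : star U * U = 1 := Unitary.coe_star_mul_self hH.eigenvectorUnitary
  have hUU' : U * star U = 1 := Unitary.coe_mul_star_self hH.eigenvectorUnitary
  have hspec : M = U * diagonal (fun i => (hH.eigenvalues i : ℂ)) * star U := by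
    conv_lhs => rw [hH.spectral_theorem]
    rfl
  have hW : diagonal (fun i => (hH.eigenvalues i : ℂ)) * (star U * V)
      = (star U * V) * diagonal (fun i => (d i : ℂ)) := by
    calc _ = star U * (U * diagonal (fun i => (hH.eigenvalues i : ℂ)) * star U) * V := by
          simp only [← mul_assoc, hUU, one_mul]
      _ = star U * (V * diagonal (fun i => (d i : ℂ)) * Vᴴ) * V := by rw [← hspec, ← hM]
      _ = _ := by simp only [mul_assoc, hV, mul_one]
  have hWp : diagonal (fun i => ((hH.eigenvalues i ^ p : ℝ) : ℂ)) * (star U * V)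
      = (star U * V) * diagonal (fun i => ((d i ^ p : ℝ) : ℂ)) := by
    ext i j
    have h := congrFun (congrFun hW i) j
    rw [diagonal_mul, mul_diagonal] at h ⊢
    rcases eq_or_ne ((star U * V) i j) 0 with h0 | h0
    · simp [h0]
    · rw [mul_comm] at h
      rw [Complex.ofReal_injective (mul_left_cancel₀ h0 h), mul_comm]
  calc mpow M p = U * diagonal (fun i => ((hH.eigenvalues i ^ p : ℝ) : ℂ)) * star U := by
        rw [mpow, dif_pos hH]
    _ = U * (diagonal (fun i => ((hH.eigenvalues i ^ p : ℝ) : ℂ)) * (star U * V)) * Vᴴ := by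
        simp only [mul_assoc, hV', mul_one]
    _ = _ := by rw [hWp]; simp only [← mul_assoc, hUU', one_mul]

lemma exists_unitary_diagonal {M : Matrix n n ℂ} (hM : M.PosSemidef) :
    ∃ (V : Matrix n n ℂ) (d : n → ℝ), Vᴴ * V = 1 ∧ V * Vᴴ = 1 ∧ (∀ i, 0 ≤ d i) ∧
      M = V * diagonal (fun i => (d i : ℂ)) * Vᴴ := by
  refine ⟨hM.1.eigenvectorUnitary, hM.1.eigenvalues,
    Unitary.coe_star_mul_self hM.1.eigenvectorUnitary,
    Unitary.coe_mul_star_self hM.1.eigenvectorUnitary, hM.eigenvalues_nonneg, ?_⟩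
  conv_lhs => rw [hM.1.spectral_theorem]
  rfl

lemma posSemidef_unitary_diagonal (V : Matrix n n ℂ) {d : n → ℝ} (hd : ∀ i, 0 ≤ d i) :
    (V * diagonal (fun i => (d i : ℂ)) * Vᴴ).PosSemidef :=
  (PosSemidef.diagonal fun i => by simpa using hd i).mul_mul_conjTranspose_same V

lemma mpow_posSemidef {M : Matrix n n ℂ} (hM : M.PosSemidef) (p : ℝ) :
    (mpow M p).PosSemidef := by
  obtain ⟨V, d, hV, -, hd, h⟩ := exists_unitary_diagonal hM
  rw [mpow_eq_of_unitary_diagonal hV d h]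
  exact posSemidef_unitary_diagonal V fun i => Real.rpow_nonneg (hd i) p

lemma mpow_conjTranspose {M : Matrix n n ℂ} (hM : M.PosSemidef) (p : ℝ) :
    (mpow M p)ᴴ = mpow M p :=
  (mpow_posSemidef hM p).1

lemma sandwich_posSemidef {M N : Matrix n n ℂ} (hM : M.PosSemidef) (hN : N.PosSemidef) (p : ℝ) :
    (mpow N p * M * mpow N p).PosSemidef := by
  have := hM.mul_mul_conjTranspose_same (mpow N p)
  rwa [mpow_conjTranspose hN] at this

lemma mpow_one {M : Matrix n n ℂ} (hM : M.PosSemidef) : mpow M 1 = M := by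
  obtain ⟨V, d, hV, -, -, h⟩ := exists_unitary_diagonal hM
  rw [mpow_eq_of_unitary_diagonal hV d h, h]
  simp only [Real.rpow_one]

lemma mpow_mul_mpow {M : Matrix n n ℂ} (hM : M.PosSemidef) {p q r : ℝ} (hr : r ≠ 0)
    (h : p + q = r) : mpow M p * mpow M q = mpow M r := by
  subst h
  obtain ⟨V, d, hV, -, hd, h⟩ := exists_unitary_diagonal hM
  simp only [mpow_eq_of_unitary_diagonal hV d h]
  calc _ = V * (diagonal (fun i => ((d i ^ p : ℝ) : ℂ)) * (Vᴴ * V) *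
        diagonal (fun i => ((d i ^ q : ℝ) : ℂ))) * Vᴴ := by simp only [mul_assoc]
    _ = _ := by
      rw [hV, mul_one, diagonal_mul_diagonal]
      simp only [Real.rpow_add' (hd _) hr, Complex.ofReal_mul]

lemma mpow_mpow {M : Matrix n n ℂ} (hM : M.PosSemidef) (p q : ℝ) :
    mpow (mpow M p) q = mpow M (p * q) := by
  obtain ⟨V, d, hV, -, hd, h⟩ := exists_unitary_diagonal hM
  rw [mpow_eq_of_unitary_diagonal hV _ (mpow_eq_of_unitary_diagonal hV d h p),
    mpow_eq_of_unitary_diagonal hV d h]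
  simp only [Real.rpow_mul (hd _)]

lemma mpow_smul {M : Matrix n n ℂ} (hM : M.PosSemidef) {k : ℝ} (hk : 0 ≤ k) (p : ℝ) :
    mpow ((k : ℂ) • M) p = ((k ^ p : ℝ) : ℂ) • mpow M p := by
  obtain ⟨V, d, hV, -, hd, h⟩ := exists_unitary_diagonal hM
  have key : ∀ (x : ℝ) (e : n → ℝ), (x : ℂ) • (V * diagonal (fun i => (e i : ℂ)) * Vᴴ)
      = V * diagonal (fun i => ((x * e i : ℝ) : ℂ)) * Vᴴ := by
    intro x e
    rw [← smul_mul_assoc, ← mul_smul_comm, ← diagonal_smul]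
    simp only [Complex.ofReal_mul]
    rfl
  have h' : (k : ℂ) • M = V * diagonal (fun i => ((k * d i : ℝ) : ℂ)) * Vᴴ := by
    rw [← key, ← h]
  rw [mpow_eq_of_unitary_diagonal hV _ h', mpow_eq_of_unitary_diagonal hV d h, key]
  simp only [Real.mul_rpow hk (hd _)]

lemma mpow_kronecker {M : Matrix n n ℂ} {N : Matrix m m ℂ} (hM : M.PosSemidef)
    (hN : N.PosSemidef) (p : ℝ) : mpow (M ⊗ₖ N) p = mpow M p ⊗ₖ mpow N p := by
  obtain ⟨V, d, hV, -, hd, h⟩ := exists_unitary_diagonal hM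
  obtain ⟨W, e, hW, -, he, h'⟩ := exists_unitary_diagonal hN
  have key : ∀ (d : n → ℝ) (e : m → ℝ),
      (V * diagonal (fun i => (d i : ℂ)) * Vᴴ) ⊗ₖ (W * diagonal (fun i => (e i : ℂ)) * Wᴴ)
      = (V ⊗ₖ W) * diagonal (fun i : n × m => ((d i.1 * e i.2 : ℝ) : ℂ)) * (V ⊗ₖ W)ᴴ := by
    intro d e
    rw [mul_kronecker_mul, mul_kronecker_mul, diagonal_kronecker_diagonal,
      conjTranspose_kronecker]
    simp only [Complex.ofReal_mul]
  have hVW : (V ⊗ₖ W)ᴴ * (V ⊗ₖ W) = 1 := by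
    rw [conjTranspose_kronecker, ← mul_kronecker_mul, hV, hW, one_kronecker_one]
  have h'' : M ⊗ₖ N = (V ⊗ₖ W) * diagonal (fun i : n × m => ((d i.1 * e i.2 : ℝ) : ℂ)) *
      (V ⊗ₖ W)ᴴ := by rw [← key, ← h, ← h']
  rw [mpow_eq_of_unitary_diagonal hVW _ h'', mpow_eq_of_unitary_diagonal hV d h,
    mpow_eq_of_unitary_diagonal hW e h', key]
  simp only [Real.mul_rpow (hd _) (he _)]

lemma mpow_reindex (e : n ≃ m) {M : Matrix n n ℂ} (hM : M.PosSemidef) (p : ℝ) :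
    mpow (reindex e e M) p = reindex e e (mpow M p) := by
  obtain ⟨V, d, hV, -, hd, h⟩ := exists_unitary_diagonal hM
  have key : ∀ d : n → ℝ, reindex e e (V * diagonal (fun i => (d i : ℂ)) * Vᴴ)
      = reindex e e V * diagonal (fun i => ((d (e.symm i) : ℝ) : ℂ)) * (reindex e e V)ᴴ := by
    intro d
    simp only [reindex_apply, conjTranspose_submatrix]
    rw [← submatrix_mul_equiv _ _ _ e.symm, ← submatrix_mul_equiv _ _ _ e.symm,
      submatrix_diagonal_equiv]
    rfl
  have hV' : (reindex e e V)ᴴ * reindex e e V = 1 := by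
    simp only [reindex_apply, conjTranspose_submatrix, submatrix_mul_equiv, hV,
      submatrix_one_equiv]
  have h' := congrArg (reindex e e) h
  rw [key] at h'
  rw [mpow_eq_of_unitary_diagonal hV' _ h', mpow_eq_of_unitary_diagonal hV d h, key]

lemma trace_mpow {M : Matrix n n ℂ} (hM : M.IsHermitian) (p : ℝ) :
    (mpow M p).trace = ((∑ i, hM.eigenvalues i ^ p : ℝ) : ℂ) := by
  rw [mpow, dif_pos hM, trace_mul_comm, ← mul_assoc,
    Unitary.coe_star_mul_self hM.eigenvectorUnitary, one_mul, trace_diagonal, Complex.ofReal_sum]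

lemma trace_mpow_eq_roots {M : Matrix n n ℂ} (hM : M.IsHermitian) (p : ℝ) :
    (mpow M p).trace = (M.charpoly.roots.map fun z : ℂ => ((z.re ^ p : ℝ) : ℂ)).sum := by
  rw [trace_mpow hM, hM.roots_charpoly_eq_eigenvalues, Multiset.map_map, Complex.ofReal_sum]
  rfl

lemma trace_mpow_mul_conjTranspose (Y : Matrix n n ℂ) (p : ℝ) :
    (mpow (Y * Yᴴ) p).trace = (mpow (Yᴴ * Y) p).trace := by
  rw [trace_mpow_eq_roots (isHermitian_mul_conjTranspose_self Y),
    trace_mpow_eq_roots (isHermitian_conjTranspose_mul_self Y), charpoly_mul_comm]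

lemma trace_mpow_re_pos {M : Matrix n n ℂ} (hM : M.PosSemidef) (h0 : M ≠ 0) (p : ℝ) :
    0 < (mpow M p).trace.re := by
  rw [trace_mpow hM.1, Complex.ofReal_re]
  have : ∃ i, hM.1.eigenvalues i ≠ 0 := by
    by_contra! h
    exact h0 (hM.1.eigenvalues_eq_zero_iff.mp (funext h))
  obtain ⟨i, hi⟩ := this
  exact Finset.sum_pos' (fun j _ => Real.rpow_nonneg (hM.eigenvalues_nonneg j) p)
    ⟨i, Finset.mem_univ i, Real.rpow_pos_of_pos ((hM.eigenvalues_nonneg i).lt_of_ne' hi) p⟩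

lemma trace_mpow_ofReal {M : Matrix n n ℂ} (hM : M.PosSemidef) (p : ℝ) :
    (mpow M p).trace = (((mpow M p).trace.re : ℝ) : ℂ) := by
  rw [trace_mpow hM.1, Complex.ofReal_re]

lemma exists_conjTranspose_mul_self {M : Matrix n n ℂ} (hM : M.PosSemidef) :
    ∃ L : Matrix n n ℂ, M = Lᴴ * L :=
  ⟨mpow M (1 / 2), by
    rw [mpow_conjTranspose hM, mpow_mul_mpow hM one_ne_zero (by norm_num), mpow_one hM]⟩

/-- A positive semidefinite matrix whose compression vanishes annihilates the compressor. -/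
lemma mul_eq_zero_of_conj_eq_zero {M S : Matrix n n ℂ} (hM : M.PosSemidef)
    (h : Sᴴ * M * S = 0) : M * S = 0 := by
  obtain ⟨L, rfl⟩ : ∃ L : Matrix n n ℂ, M = Lᴴ * L := exists_conjTranspose_mul_self hM
  have : L * S = 0 := by
    rw [← conjTranspose_mul_self_eq_zero, conjTranspose_mul, ← h]
    simp only [mul_assoc]
  rw [mul_assoc, this, mul_zero]

/-- Orthogonal projection onto the support of a positive semidefinite matrix. -/
def suppProj (M : Matrix n n ℂ) : Matrix n n ℂ := mpow M 1 * mpow M (-1)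

lemma mpow_mul_mpow_neg {M : Matrix n n ℂ} (hM : M.PosSemidef) {p q : ℝ} (hp : p ≠ 0)
    (h : p + q = 0) : mpow M p * mpow M q = suppProj M := by
  obtain rfl : q = -p := by linarith
  obtain ⟨V, d, hV, -, hd, h⟩ := exists_unitary_diagonal hM
  have key : ∀ p : ℝ, p ≠ 0 → mpow M p * mpow M (-p)
      = V * diagonal (fun i => if d i = 0 then 0 else 1) * Vᴴ := by
    intro p hp
    simp only [mpow_eq_of_unitary_diagonal hV d h]
    calc _ = V * (diagonal (fun i => ((d i ^ p : ℝ) : ℂ)) * (Vᴴ * V) *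
          diagonal (fun i => ((d i ^ (-p) : ℝ) : ℂ))) * Vᴴ := by simp only [mul_assoc]
      _ = _ := by
        rw [hV, mul_one, diagonal_mul_diagonal]
        congr 3
        ext i
        split_ifs with h0
        · simp [h0, Real.zero_rpow hp]
        · rw [← Complex.ofReal_mul, Real.rpow_neg (hd i),
            mul_inv_cancel₀ (Real.rpow_pos_of_pos ((hd i).lt_of_ne' h0) p).ne', Complex.ofReal_one]
  rw [suppProj, key p hp, key 1 one_ne_zero]

lemma suppProj_mul_mpow {M : Matrix n n ℂ} (hM : M.PosSemidef) {p : ℝ} (hp : p ≠ 0) :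
    suppProj M * mpow M p = mpow M p := by
  rw [← mpow_mul_mpow_neg hM (neg_ne_zero.mpr hp) (neg_add_cancel p), mul_assoc,
    mpow_mul_mpow hM (r := 2 * p) (by simpa using hp) (by ring),
    mpow_mul_mpow hM hp (by ring)]

lemma mpow_mul_suppProj {M : Matrix n n ℂ} (hM : M.PosSemidef) {p : ℝ} (hp : p ≠ 0) :
    mpow M p * suppProj M = mpow M p := by
  rw [← mpow_mul_mpow_neg hM hp (add_neg_cancel p), ← mul_assoc,
    mpow_mul_mpow hM (r := 2 * p) (by simpa using hp) (by ring),
    mpow_mul_mpow hM hp (by ring)]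

lemma suppProj_mul_self {M : Matrix n n ℂ} (hM : M.PosSemidef) :
    suppProj M * suppProj M = suppProj M := by
  nth_rw 2 [suppProj]
  rw [← mul_assoc, suppProj_mul_mpow hM one_ne_zero, suppProj]

lemma suppProj_conjTranspose {M : Matrix n n ℂ} (hM : M.PosSemidef) :
    (suppProj M)ᴴ = suppProj M := by
  conv_lhs => rw [suppProj, conjTranspose_mul, mpow_conjTranspose hM, mpow_conjTranspose hM]
  exact mpow_mul_mpow_neg hM (by norm_num) (by norm_num)

lemma mul_suppProj_of_mul_mpow_eq_zero {M S : Matrix n n ℂ} (hM : M.PosSemidef) {p : ℝ}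
    (hp : p ≠ 0) (h : S * mpow M p = 0) : S * suppProj M = 0 := by
  rw [← mpow_mul_mpow_neg hM hp (add_neg_cancel p), ← mul_assoc, h, zero_mul]

lemma suppProj_kronecker {M : Matrix n n ℂ} {N : Matrix m m ℂ} (hM : M.PosSemidef)
    (hN : N.PosSemidef) : suppProj (M ⊗ₖ N) = suppProj M ⊗ₖ suppProj N := by
  simp only [suppProj, mpow_kronecker hM hN, mul_kronecker_mul]

lemma suppSubset_iff_mul_suppProj {M N : Matrix n n ℂ} (hN : N.PosSemidef) :
    suppSubset M N ↔ M * suppProj N = M := by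
  constructor
  · intro h
    have h1 : M * (1 - suppProj N) = 0 := by
      ext i j
      have := h ((1 - suppProj N) *ᵥ Pi.single j 1) (by
        rw [mulVec_mulVec, mul_sub, mul_one]
        nth_rw 2 [← mpow_one hN]
        rw [mpow_mul_suppProj hN one_ne_zero, mpow_one hN, sub_self, zero_mulVec])
      rw [mulVec_mulVec, mulVec_single_one] at this
      exact congrFun this i
    rw [mul_sub, mul_one, sub_eq_zero] at h1
    exact h1.symm
  · intro h v hv
    have hP : suppProj N = mpow N (-1) * N := by
      nth_rw 3 [← mpow_one hN]
      exact (mpow_mul_mpow_neg hN (by norm_num) (by norm_num)).symm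
    rw [← h, ← mulVec_mulVec, hP, ← mulVec_mulVec, hv, mulVec_zero, mulVec_zero]

/-- If the divergence is finite then the sandwiched operator does not vanish. -/
lemma sandwich_ne_zero_of_D_ne_top {α : ℝ} {M N : Matrix n n ℂ} (hM : M.PosSemidef)
    (hN : N.PosSemidef) (hM0 : M ≠ 0) (h : D α M N ≠ ⊤) {p : ℝ} (hp : p ≠ 0) :
    mpow N p * M * mpow N p ≠ 0 := by
  intro h0
  have h1 : M * mpow N p = 0 :=
    mul_eq_zero_of_conj_eq_zero hM (by rwa [mpow_conjTranspose hN])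
  have h2 : M * suppProj N = 0 := mul_suppProj_of_mul_mpow_eq_zero hN hp h1
  have h3 : M * N = 0 := by
    rw [← mpow_one hN, ← suppProj_mul_mpow hN one_ne_zero, ← mul_assoc, h2, zero_mul]
  have h4 : N * M = 0 := by
    rw [← conjTranspose_inj, conjTranspose_mul, hM.1.eq, hN.1.eq, h3, conjTranspose_zero]
  refine h (if_neg ?_)
  rintro (⟨-, h5⟩ | h5)
  · exact h5 ⟨h3, h4⟩
  · rw [suppSubset_iff_mul_suppProj hN, h2] at h5
    exact hM0 h5.symm

lemma mul_ne_zero_of_sandwich_ne_zero {M N : Matrix n n ℂ} (hN : N.PosSemidef) {p : ℝ}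
    (hp : p ≠ 0) (h : mpow N p * M * mpow N p ≠ 0) : M * N ≠ 0 := by
  intro h0
  have h1 : M * mpow N p = 0 := by
    rw [← suppProj_mul_mpow hN hp, suppProj, mpow_one hN, mul_assoc, ← mul_assoc, h0, zero_mul]
  exact h (by rw [mul_assoc, h1, mul_zero])

lemma D_of_sandwich_ne_zero {α : ℝ} {M N : Matrix n n ℂ} (hN : N.PosSemidef) (hα : α < 1)
    {p : ℝ} (hp : p ≠ 0) (h : mpow N p * M * mpow N p ≠ 0) : D α M N = (DR α M N : ℝ) :=
  if_pos (Or.inl ⟨hα, fun h' => mul_ne_zero_of_sandwich_ne_zero hN hp h h'.1⟩)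

lemma D_of_suppSubset {α : ℝ} {M N : Matrix n n ℂ} (h : suppSubset M N) :
    D α M N = (DR α M N : ℝ) :=
  if_pos (Or.inr h)

lemma D_ne_bot (α : ℝ) (M N : Matrix n n ℂ) : D α M N ≠ ⊥ := by
  unfold D
  split_ifs
  · exact EReal.coe_ne_bot _
  · exact top_ne_bot

lemma D_eq_DR_of_ne_top {α : ℝ} {M N : Matrix n n ℂ} (h : D α M N ≠ ⊤) :
    D α M N = (DR α M N : ℝ) := by
  unfold D at h ⊢
  split_ifs at h ⊢ with h1
  · rfl
  · exact absurd rfl h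

lemma suppSubset_of_D_ne_top {α : ℝ} (hα : 1 < α) {M N : Matrix n n ℂ} (h : D α M N ≠ ⊤) :
    suppSubset M N := by
  by_contra h'
  refine h (if_neg ?_)
  rintro (⟨h1, -⟩ | h1)
  · linarith
  · exact h' h1

lemma D_reindex (e : n ≃ m) (α : ℝ) {M N : Matrix n n ℂ} (hM : M.PosSemidef)
    (hN : N.PosSemidef) : D α (reindex e e M) (reindex e e N) = D α M N := by
  have hmul : ∀ X Y : Matrix n n ℂ,
      reindex e e X * reindex e e Y = reindex e e (X * Y) := fun X Y => by
    simp only [reindex_apply, submatrix_mul_equiv]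
  have htr : ∀ X : Matrix n n ℂ, (reindex e e X).trace = X.trace := fun X =>
    Equiv.sum_comp e.symm fun i => X i i
  have hzero : ∀ X : Matrix n n ℂ, reindex e e X = 0 ↔ X = 0 := fun X =>
    ⟨fun h => (reindex e e).injective (h.trans (by ext; rfl)), fun h => by rw [h]; ext; rfl⟩
  have hDR : DR α (reindex e e M) (reindex e e N) = DR α M N := by
    rw [DR, DR, mpow_reindex e hN, hmul, hmul, mpow_reindex e (sandwich_posSemidef hM hN _), htr, htr]
  have hsupp : suppSubset (reindex e e M) (reindex e e N) ↔ suppSubset M N := by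
    have hN' : (reindex e e N).PosSemidef := hN.submatrix e.symm
    rw [suppSubset_iff_mul_suppProj hN', suppSubset_iff_mul_suppProj hN, suppProj, suppProj,
      mpow_reindex e hN, mpow_reindex e hN, hmul, hmul, EmbeddingLike.apply_eq_iff_eq]
  have hcond : (α < 1 ∧ ¬ (reindex e e M * reindex e e N = 0 ∧ reindex e e N * reindex e e M = 0)) ∨
      suppSubset (reindex e e M) (reindex e e N) ↔
      (α < 1 ∧ ¬ (M * N = 0 ∧ N * M = 0)) ∨ suppSubset M N := by
    rw [hmul, hmul, hzero, hzero, hsupp]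
  unfold D
  split_ifs with h1 h2 h2
  · rw [hDR]
  · exact absurd (hcond.mp h1) h2
  · exact absurd (hcond.mpr h2) h1
  · rfl

end Power

section PartialTrace

lemma mpow_kronecker_one_conjTranspose {n m : Type*} [Fintype n] [DecidableEq n] [DecidableEq m]
    {M : Matrix n n ℂ} (hM : M.PosSemidef) (p : ℝ) :
    (mpow M p ⊗ₖ (1 : Matrix m m ℂ))ᴴ = mpow M p ⊗ₖ (1 : Matrix m m ℂ) := by
  rw [conjTranspose_kronecker, conjTranspose_one, mpow_conjTranspose hM]

variable {n m : Type*}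

lemma trace_ptB [Fintype n] [Fintype m] (M : Matrix (n × m) (n × m) ℂ) : (ptB M).trace = M.trace := by
  simp only [trace, diag_apply, ptB, of_apply, Fintype.sum_prod_type]

lemma ptB_kronecker_one_mul [Fintype n] [Fintype m] [DecidableEq m] (S : Matrix n n ℂ) (M : Matrix (n × m) (n × m) ℂ) :
    ptB (S ⊗ₖ (1 : Matrix m m ℂ) * M) = S * ptB M := by
  ext i j
  simp only [ptB, of_apply, mul_apply, Fintype.sum_prod_type, kroneckerMap_apply, one_apply,
    mul_ite, mul_one, mul_zero, ite_mul, zero_mul, Finset.sum_ite_eq, Finset.mem_univ, if_true,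
    Finset.mul_sum]
  exact Finset.sum_comm

lemma ptB_mul_kronecker_one [Fintype n] [Fintype m] [DecidableEq m] (S : Matrix n n ℂ) (M : Matrix (n × m) (n × m) ℂ) :
    ptB (M * S ⊗ₖ (1 : Matrix m m ℂ)) = ptB M * S := by
  ext i j
  simp only [ptB, of_apply, mul_apply, Fintype.sum_prod_type, kroneckerMap_apply, one_apply,
    mul_ite, mul_one, mul_zero, Finset.sum_ite_eq', Finset.mem_univ, if_true,
    Finset.sum_mul]
  exact Finset.sum_comm

lemma ptB_posSemidef [Fintype m] {M : Matrix (n × m) (n × m) ℂ} (hM : M.PosSemidef) :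
    (ptB M).PosSemidef := by
  have : ptB M = ∑ b, M.submatrix (fun a => (a, b)) (fun a => (a, b)) := by
    ext i j
    simp [ptB, Matrix.sum_apply]
  rw [this]
  exact posSemidef_sum _ fun b _ => hM.submatrix _

variable [Fintype n] [DecidableEq n] [Fintype m] [DecidableEq m]

/-- An operator vanishing on the marginal vanishes on the joint state. -/
lemma mul_kronecker_one_eq_zero {M : Matrix (n × m) (n × m) ℂ} (hM : M.PosSemidef)
    {S : Matrix n n ℂ} (h : ptB M * S = 0) : M * S ⊗ₖ (1 : Matrix m m ℂ) = 0 := by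
  apply mul_eq_zero_of_conj_eq_zero hM
  rw [← (hM.conjTranspose_mul_mul_same _).trace_eq_zero_iff, ← trace_ptB, ptB_mul_kronecker_one,
    conjTranspose_kronecker, conjTranspose_one, ptB_kronecker_one_mul, mul_assoc, h, mul_zero,
    trace_zero]

lemma mul_kronecker_one_of_ptB_mul {M : Matrix (n × m) (n × m) ℂ} (hM : M.PosSemidef)
    {S : Matrix n n ℂ} (h : ptB M * S = ptB M) : M * S ⊗ₖ (1 : Matrix m m ℂ) = M := by
  have h1 : M * (1 - S) ⊗ₖ (1 : Matrix m m ℂ) = 0 :=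
    mul_kronecker_one_eq_zero hM (by rw [mul_sub, mul_one, h, sub_self])
  rw [sub_eq_add_neg, add_kronecker, one_kronecker_one, mul_add, mul_one] at h1
  rw [← sub_eq_zero, ← neg_eq_zero, neg_sub, sub_eq_add_neg, ← mul_neg]
  convert h1 using 3
  ext
  simp [kroneckerMap_apply]

lemma conditional_sandwich {M : Matrix (n × m) (n × m) ℂ} (hM : M.PosSemidef) :
    mpow (ptB M) (1 / 2) ⊗ₖ (1 : Matrix m m ℂ) *
      (mpow (ptB M) (-(1 / 2)) ⊗ₖ (1 : Matrix m m ℂ) * M *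
        mpow (ptB M) (-(1 / 2)) ⊗ₖ (1 : Matrix m m ℂ)) *
      mpow (ptB M) (1 / 2) ⊗ₖ (1 : Matrix m m ℂ) = M := by
  have hR := ptB_posSemidef hM
  have h1 : M * suppProj (ptB M) ⊗ₖ (1 : Matrix m m ℂ) = M := by
    apply mul_kronecker_one_of_ptB_mul hM
    nth_rw 1 3 [← mpow_one hR]
    exact mpow_mul_suppProj hR one_ne_zero
  have h2 : suppProj (ptB M) ⊗ₖ (1 : Matrix m m ℂ) * M = M := by
    rw [← conjTranspose_inj, conjTranspose_mul, conjTranspose_kronecker, conjTranspose_one,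
      suppProj_conjTranspose hR, hM.1.eq, h1]
  calc _ = (mpow (ptB M) (1 / 2) ⊗ₖ (1 : Matrix m m ℂ) *
        mpow (ptB M) (-(1 / 2)) ⊗ₖ (1 : Matrix m m ℂ)) * M *
        (mpow (ptB M) (-(1 / 2)) ⊗ₖ (1 : Matrix m m ℂ) *
        mpow (ptB M) (1 / 2) ⊗ₖ (1 : Matrix m m ℂ)) := by simp only [mul_assoc]
    _ = M := by
      rw [← mul_kronecker_mul, ← mul_kronecker_mul, one_mul,
        mpow_mul_mpow_neg hR (by norm_num) (by norm_num),
        mpow_mul_mpow_neg hR (by norm_num) (by norm_num), h2, h1]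

end PartialTrace

section Chain

variable {n m : Type*} [Fintype n] [DecidableEq n] [Fintype m] [DecidableEq m]

/-- The tilted operator `R^{1/2} τ^{(1-α)/α} R^{1/2}`. -/
def tilt (α : ℝ) (R τ : Matrix n n ℂ) : Matrix n n ℂ :=
  mpow R (1 / 2) * mpow τ ((1 - α) / α) * mpow R (1 / 2)

lemma tilt_posSemidef (α : ℝ) {R τ : Matrix n n ℂ} (hR : R.PosSemidef) (hτ : τ.PosSemidef) :
    (tilt α R τ).PosSemidef :=
  sandwich_posSemidef (mpow_posSemidef hτ _) hR _

lemma mpow_zero_matrix {p : ℝ} (hp : p ≠ 0) : mpow (0 : Matrix n n ℂ) p = 0 := by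
  simpa [Real.zero_rpow hp] using mpow_smul (PosSemidef.zero (n := n) (R := ℂ)) le_rfl p

lemma suppProj_mul_mpow_tilt {α : ℝ} {R τ : Matrix n n ℂ} (hR : R.PosSemidef)
    (hτ : τ.PosSemidef) {p : ℝ} (hp : p ≠ 0) :
    suppProj R * mpow (tilt α R τ) p = mpow (tilt α R τ) p := by
  have hX := tilt_posSemidef α hR hτ
  have h : suppProj R * tilt α R τ = tilt α R τ := by
    rw [tilt, ← mul_assoc, ← mul_assoc, suppProj_mul_mpow hR (by norm_num)]
  rw [← suppProj_mul_mpow hX hp, suppProj.eq_1 (tilt α R τ), mpow_one hX, ← mul_assoc,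
    ← mul_assoc, h]

lemma trace_mpow_sandwich {T E K G : Matrix n n ℂ} (hT : Tᴴ = T) (hE : Eᴴ = E)
    (hK : K = G * Gᴴ) (p : ℝ) :
    (mpow (T * (E * K * E) * T) p).trace = (mpow (Gᴴ * (E * (T * T) * E) * G) p).trace := by
  have h1 : T * (E * K * E) * T = (T * E * G) * (T * E * G)ᴴ := by
    rw [hK, conjTranspose_mul, conjTranspose_mul, hT, hE]
    simp only [mul_assoc]
  have h2 : Gᴴ * (E * (T * T) * E) * G = (T * E * G)ᴴ * (T * E * G) := by
    rw [conjTranspose_mul, conjTranspose_mul, hT, hE]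
    simp only [mul_assoc]
  rw [h1, h2, trace_mpow_mul_conjTranspose]

/-- The conditional operator `ρ_{B|A} = ρ_A^{-1/2} ρ_{AB} ρ_A^{-1/2}`. -/
def condOp (M : Matrix (n × m) (n × m) ℂ) : Matrix (n × m) (n × m) ℂ :=
  mpow (ptB M) (-(1 / 2)) ⊗ₖ (1 : Matrix m m ℂ) * M *
    mpow (ptB M) (-(1 / 2)) ⊗ₖ (1 : Matrix m m ℂ)

/-- The state with marginal `ν` and the same conditional operator as `M`. -/
def withMarginal (ν : Matrix n n ℂ) (M : Matrix (n × m) (n × m) ℂ) :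
    Matrix (n × m) (n × m) ℂ :=
  mpow ν (1 / 2) ⊗ₖ (1 : Matrix m m ℂ) * condOp M * mpow ν (1 / 2) ⊗ₖ (1 : Matrix m m ℂ)

lemma condOp_posSemidef {M : Matrix (n × m) (n × m) ℂ} (hM : M.PosSemidef) :
    (condOp M).PosSemidef := by
  have := hM.mul_mul_conjTranspose_same (mpow (ptB M) (-(1 / 2)) ⊗ₖ (1 : Matrix m m ℂ))
  rwa [mpow_kronecker_one_conjTranspose (ptB_posSemidef hM)] at this

lemma withMarginal_posSemidef {ν : Matrix n n ℂ} (hν : ν.PosSemidef)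
    {M : Matrix (n × m) (n × m) ℂ} (hM : M.PosSemidef) : (withMarginal ν M).PosSemidef := by
  have := (condOp_posSemidef hM).mul_mul_conjTranspose_same
    (mpow ν (1 / 2) ⊗ₖ (1 : Matrix m m ℂ))
  rwa [mpow_kronecker_one_conjTranspose hν] at this

lemma withMarginal_ptB {M : Matrix (n × m) (n × m) ℂ} (hM : M.PosSemidef) :
    withMarginal (ptB M) M = M :=
  conditional_sandwich hM

lemma ptB_withMarginal {ν : Matrix n n ℂ} (hν : ν.PosSemidef)
    {M : Matrix (n × m) (n × m) ℂ} (hM : M.PosSemidef)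
    (h : suppProj (ptB M) * mpow ν (1 / 2) = mpow ν (1 / 2)) : ptB (withMarginal ν M) = ν := by
  have hR := ptB_posSemidef hM
  have hK : ptB (condOp M) = suppProj (ptB M) := by
    rw [condOp, ptB_mul_kronecker_one, ptB_kronecker_one_mul]
    nth_rw 2 [← mpow_one hR]
    rw [mpow_mul_mpow hR (r := 1 / 2) (by norm_num) (by norm_num),
      mpow_mul_mpow_neg hR (by norm_num) (by norm_num)]
  rw [withMarginal, ptB_mul_kronecker_one, ptB_kronecker_one_mul, hK, mul_assoc, h,
    mpow_mul_mpow hν one_ne_zero (by norm_num), mpow_one hν]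

/-- The sandwiched trace of `withMarginal ν M` relative to a product operator. -/
lemma trace_mpow_withMarginal {α : ℝ} (h0 : 0 < α) (h1 : α ≠ 1) {ν τ : Matrix n n ℂ}
    (hν : ν.PosSemidef) (hτ : τ.PosSemidef) {ω : Matrix m m ℂ} (hω : ω.PosSemidef)
    {M G : Matrix (n × m) (n × m) ℂ} (hG : condOp M = G * Gᴴ) :
    (mpow (mpow (τ ⊗ₖ ω) ((1 - α) / (2 * α)) * withMarginal ν M *
      mpow (τ ⊗ₖ ω) ((1 - α) / (2 * α))) α).trace =
    (mpow (Gᴴ * tilt α ν τ ⊗ₖ mpow ω ((1 - α) / α) * G) α).trace := by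
  have hs : (1 - α) / α ≠ 0 := div_ne_zero (sub_ne_zero.mpr h1.symm) h0.ne'
  have hτω := hτ.kronecker hω
  rw [withMarginal, trace_mpow_sandwich (mpow_conjTranspose hτω _)
    (mpow_kronecker_one_conjTranspose hν _) hG,
    mpow_mul_mpow hτω hs (by field_simp; ring), mpow_kronecker hτ hω,
    ← mul_kronecker_mul, ← mul_kronecker_mul, one_mul, mul_one, tilt]

lemma trace_mpow_tilt {α : ℝ} (h0 : 0 < α) (h1 : α ≠ 1) {R τ : Matrix n n ℂ}
    (hR : R.PosSemidef) (hτ : τ.PosSemidef) :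
    (mpow (mpow τ ((1 - α) / (2 * α)) * R * mpow τ ((1 - α) / (2 * α))) α).trace =
    (mpow (tilt α R τ) α).trace := by
  have hs : (1 - α) / α ≠ 0 := div_ne_zero (sub_ne_zero.mpr h1.symm) h0.ne'
  have h := trace_mpow_sandwich (mpow_conjTranspose hτ ((1 - α) / (2 * α)))
    (mpow_conjTranspose hR (1 / 2)) (K := 1) (G := 1) (by simp) α
  rwa [mul_one, mpow_mul_mpow hR one_ne_zero (by norm_num), mpow_one hR,
    mpow_mul_mpow hτ hs (by field_simp; ring), conjTranspose_one, one_mul, mul_one] at h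

lemma tilt_self {α : ℝ} (h0 : 0 < α) {ν : Matrix n n ℂ} (hν : ν.PosSemidef) (h1 : α ≠ 1) :
    tilt α ν ν = mpow ν (1 / α) := by
  have hs : (1 - α) / α ≠ 0 := div_ne_zero (sub_ne_zero.mpr h1.symm) h0.ne'
  have hα : 1 / (2 * α) ≠ 0 := by positivity
  rw [tilt, ← mpow_mul_mpow hν (p := (1 - α) / (2 * α)) (q := (1 - α) / (2 * α)) hs
    (by field_simp; ring), ← mul_assoc, mpow_mul_mpow hν hα (by field_simp; ring), mul_assoc,
    mpow_mul_mpow hν hα (by field_simp; ring),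
    mpow_mul_mpow hν (r := 1 / α) (by positivity) (by field_simp; ring)]

/-- The tilted operator is invertible on the support of `R` if `τ` dominates `R`. -/
lemma mpow_mul_suppProj_tilt {α : ℝ} (h0 : 0 < α) (h1 : α ≠ 1) {R τ : Matrix n n ℂ}
    (hR : R.PosSemidef) (hτ : τ.PosSemidef) (h : suppSubset R τ) :
    mpow R (1 / 2) * suppProj (tilt α R τ) = mpow R (1 / 2) := by
  have hs : (1 - α) / α ≠ 0 := div_ne_zero (sub_ne_zero.mpr h1.symm) h0.ne'
  have hX := tilt_posSemidef α hR hτ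
  have hτR : mpow R (1 / 2) * suppProj τ = mpow R (1 / 2) := by
    rw [suppSubset_iff_mul_suppProj hτ] at h
    have hRR : mpow R (1 / 2) = mpow R (-(1 / 2)) * R := by
      nth_rw 3 [← mpow_one hR]
      rw [mpow_mul_mpow hR (r := 1 / 2) (by norm_num) (by norm_num)]
    rw [hRR, mul_assoc, h]
  have hτR' : suppProj τ * mpow R (1 / 2) = mpow R (1 / 2) := by
    rw [← conjTranspose_inj, conjTranspose_mul, suppProj_conjTranspose hτ,
      mpow_conjTranspose hR, hτR]
  have hz : tilt α R τ * (1 - suppProj (tilt α R τ)) = 0 := by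
    rw [mul_sub, mul_one]
    nth_rw 2 [← mpow_one hX]
    rw [mpow_mul_suppProj hX one_ne_zero, mpow_one hX, sub_self]
  have h2 : mpow τ ((1 - α) / α) * (mpow R (1 / 2) * (1 - suppProj (tilt α R τ))) = 0 := by
    apply mul_eq_zero_of_conj_eq_zero (mpow_posSemidef hτ _)
    rw [conjTranspose_mul, mpow_conjTranspose hR, mul_assoc, mul_assoc,
      ← mul_assoc (mpow τ _), ← mul_assoc (mpow R _), ← mul_assoc (mpow R _), ← tilt, hz,
      mul_zero]
  have h3 : mpow R (1 / 2) * (1 - suppProj (tilt α R τ)) = 0 := by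
    rw [← hτR', ← mpow_mul_mpow_neg hτ (neg_ne_zero.mpr hs) (neg_add_cancel _), mul_assoc,
      mul_assoc, h2, mul_zero]
  rw [mul_sub, mul_one, sub_eq_zero] at h3
  exact h3.symm

/-- The normalized power `X^α / Tr X^α` of the tilted operator. -/
def tiltState (α : ℝ) (R τ : Matrix n n ℂ) : Matrix n n ℂ :=
  (mpow (tilt α R τ) α).trace⁻¹ • mpow (tilt α R τ) α

section TiltState

variable {α : ℝ} {R τ : Matrix n n ℂ}

lemma tiltState_eq (hR : R.PosSemidef) (hτ : τ.PosSemidef) : tiltState α R τ =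
    (((mpow (tilt α R τ) α).trace.re⁻¹ : ℝ) : ℂ) • mpow (tilt α R τ) α := by
  rw [tiltState, trace_mpow_ofReal (tilt_posSemidef α hR hτ), Complex.ofReal_re,
    Complex.ofReal_inv]

lemma trace_mpow_re_nonneg {M : Matrix n n ℂ} (hM : M.PosSemidef) (p : ℝ) :
    0 ≤ (mpow M p).trace.re :=
  (Complex.le_def.mp (mpow_posSemidef hM p).trace_nonneg).1

lemma tiltState_posSemidef (hR : R.PosSemidef) (hτ : τ.PosSemidef) :
    (tiltState α R τ).PosSemidef := by
  have hX := tilt_posSemidef α hR hτ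
  rw [tiltState_eq hR hτ]
  exact (mpow_posSemidef hX α).smul
    (Complex.zero_le_real.mpr (inv_nonneg.mpr (trace_mpow_re_nonneg hX α)))

lemma mpow_tiltState (hR : R.PosSemidef) (hτ : τ.PosSemidef) (p : ℝ) :
    mpow (tiltState α R τ) p =
      ((((mpow (tilt α R τ) α).trace.re⁻¹) ^ p : ℝ) : ℂ) • mpow (tilt α R τ) (α * p) := by
  have hX := tilt_posSemidef α hR hτ
  rw [tiltState_eq hR hτ, mpow_smul (mpow_posSemidef hX α)
    (inv_nonneg.mpr (trace_mpow_re_nonneg hX α)), mpow_mpow hX]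

lemma ptB_withMarginal_tiltState (h0 : 0 < α) {M : Matrix (n × m) (n × m) ℂ}
    (hM : M.PosSemidef) (hτ : τ.PosSemidef) :
    ptB (withMarginal (tiltState α (ptB M) τ) M) = tiltState α (ptB M) τ := by
  have hR := ptB_posSemidef hM
  apply ptB_withMarginal (tiltState_posSemidef hR hτ) hM
  rw [mpow_tiltState hR hτ, mul_smul_comm, suppProj_mul_mpow_tilt hR hτ (by positivity)]

/-- Multiplicativity of the sandwiched trace along the tilted chain. -/
lemma trace_mpow_chain (h0 : 0 < α) (h1 : α ≠ 1) {M : Matrix (n × m) (n × m) ℂ}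
    (hM : M.PosSemidef) (hτ : τ.PosSemidef) {ω : Matrix m m ℂ} (hω : ω.PosSemidef)
    (hc : 0 < (mpow (tilt α (ptB M) τ) α).trace.re) :
    (mpow (mpow (τ ⊗ₖ ω) ((1 - α) / (2 * α)) * M *
      mpow (τ ⊗ₖ ω) ((1 - α) / (2 * α))) α).trace.re =
    (mpow (tilt α (ptB M) τ) α).trace.re *
    (mpow (mpow (tiltState α (ptB M) τ ⊗ₖ ω) ((1 - α) / (2 * α)) *
      withMarginal (tiltState α (ptB M) τ) M *
      mpow (tiltState α (ptB M) τ ⊗ₖ ω) ((1 - α) / (2 * α))) α).trace.re := by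
  have hR := ptB_posSemidef hM
  have hν := tiltState_posSemidef (α := α) hR hτ
  have hX := tilt_posSemidef α hR hτ
  obtain ⟨L, hL⟩ := exists_conjTranspose_mul_self (condOp_posSemidef hM)
  have hG : condOp M = Lᴴ * Lᴴᴴ := by rw [hL, conjTranspose_conjTranspose]
  have e1 := trace_mpow_withMarginal h0 h1 hR hτ hω hG
  rw [withMarginal_ptB hM] at e1
  have hpsd := (hX.kronecker (mpow_posSemidef hω ((1 - α) / α))).conjTranspose_mul_mul_same Lᴴ
  rw [e1, trace_mpow_withMarginal h0 h1 hν hν hω hG, tilt_self h0 hν h1,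
    mpow_tiltState hR hτ, mul_one_div_cancel h0.ne', mpow_one hX, smul_kronecker, mul_smul_comm,
    smul_mul_assoc, mpow_smul hpsd (by positivity), trace_smul, smul_eq_mul,
    Complex.re_ofReal_mul, ← Real.rpow_mul (inv_nonneg.mpr hc.le), one_div_mul_cancel h0.ne',
    Real.rpow_one, mul_inv_cancel_left₀ hc.ne']

lemma suppSubset_kronecker_of_chain (h0 : 0 < α) (h1 : α ≠ 1) {M : Matrix (n × m) (n × m) ℂ}
    (hM : M.PosSemidef) (hτ : τ.PosSemidef) {ω : Matrix m m ℂ} (hω : ω.PosSemidef)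
    (hc : 0 < (mpow (tilt α (ptB M) τ) α).trace.re) (hτ' : suppSubset (ptB M) τ)
    (hν' : suppSubset (withMarginal (tiltState α (ptB M) τ) M) (tiltState α (ptB M) τ ⊗ₖ ω)) :
    suppSubset M (τ ⊗ₖ ω) := by
  have hR := ptB_posSemidef hM
  have hν := tiltState_posSemidef (α := α) hR hτ
  have hX := tilt_posSemidef α hR hτ
  set ν := tiltState α (ptB M) τ with hνdef
  have hsupp : suppProj ν = suppProj (tilt α (ptB M) τ) := by
    rw [← mpow_mul_mpow_neg hν one_ne_zero (add_neg_cancel 1), mpow_tiltState hR hτ,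
      mpow_tiltState hR hτ, smul_mul_assoc, mul_smul_comm, smul_smul,
      mpow_mul_mpow_neg hX (p := α * 1) (by positivity) (by ring), ← Complex.ofReal_mul,
      ← Real.rpow_add (inv_pos.mpr hc), add_neg_cancel, Real.rpow_zero, Complex.ofReal_one,
      one_smul]
  have hRν : mpow (ptB M) (1 / 2) = suppProj ν * mpow (ptB M) (1 / 2) := by
    have h := mpow_mul_suppProj_tilt h0 h1 hR hτ hτ'
    rw [← hsupp] at h
    conv_lhs => rw [← mpow_conjTranspose hR, ← h]
    rw [conjTranspose_mul, suppProj_conjTranspose hν, mpow_conjTranspose hR]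
  rw [suppSubset_iff_mul_suppProj (hν.kronecker hω), suppProj_kronecker hν hω] at hν'
  have hνω : withMarginal ν M * (1 : Matrix n n ℂ) ⊗ₖ suppProj ω = withMarginal ν M := by
    conv_lhs => rw [← hν']
    rw [mul_assoc, ← mul_kronecker_mul, suppProj_mul_self hω, mul_one, hν']
  have hMω : M * (1 : Matrix n n ℂ) ⊗ₖ suppProj ω = M := by
    have hM' : M = (mpow (ptB M) (1 / 2) * mpow ν (-(1 / 2))) ⊗ₖ (1 : Matrix m m ℂ) *
        withMarginal ν M * (mpow ν (-(1 / 2)) * mpow (ptB M) (1 / 2)) ⊗ₖ (1 : Matrix m m ℂ) := by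
      have hν1 : mpow ν (1 / 2) * (mpow ν (-(1 / 2)) * mpow (ptB M) (1 / 2)) =
          mpow (ptB M) (1 / 2) := by
        rw [← mul_assoc, mpow_mul_mpow_neg hν (by norm_num) (by norm_num), ← hRν]
      have hν2 : mpow (ptB M) (1 / 2) * mpow ν (-(1 / 2)) * mpow ν (1 / 2) =
          mpow (ptB M) (1 / 2) := by
        rw [← conjTranspose_inj]
        simp only [conjTranspose_mul, mpow_conjTranspose hν, mpow_conjTranspose hR, hν1]
      conv_lhs => rw [← withMarginal_ptB hM, withMarginal]
      conv_rhs => rw [withMarginal]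
      rw [mul_assoc _ _ ((mpow ν (-(1 / 2)) * mpow (ptB M) (1 / 2)) ⊗ₖ (1 : Matrix m m ℂ)),
        mul_assoc _ _ ((mpow ν (-(1 / 2)) * mpow (ptB M) (1 / 2)) ⊗ₖ (1 : Matrix m m ℂ)),
        ← mul_kronecker_mul, hν1, ← mul_assoc, ← mul_assoc, ← mul_kronecker_mul, hν2, one_mul]
    have hcomm : ∀ S : Matrix n n ℂ, S ⊗ₖ (1 : Matrix m m ℂ) * (1 : Matrix n n ℂ) ⊗ₖ suppProj ω =
        (1 : Matrix n n ℂ) ⊗ₖ suppProj ω * S ⊗ₖ (1 : Matrix m m ℂ) := fun S => by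
      rw [← mul_kronecker_mul, ← mul_kronecker_mul, mul_one, mul_one, one_mul, one_mul]
    conv_lhs => rw [hM', mul_assoc, hcomm, ← mul_assoc, mul_assoc _ (withMarginal ν M), hνω]
    exact hM'.symm
  have hMτ : M * suppProj τ ⊗ₖ (1 : Matrix m m ℂ) = M :=
    mul_kronecker_one_of_ptB_mul hM ((suppSubset_iff_mul_suppProj hτ).mp hτ')
  rw [suppSubset_iff_mul_suppProj (hτ.kronecker hω), suppProj_kronecker hτ hω]
  calc M * suppProj τ ⊗ₖ suppProj ω
      = M * suppProj τ ⊗ₖ (1 : Matrix m m ℂ) * (1 : Matrix n n ℂ) ⊗ₖ suppProj ω := by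
        rw [mul_assoc, ← mul_kronecker_mul, mul_one, one_mul]
    _ = M := by rw [hMτ, hMω]

/-- Chain rule for the sandwiched divergence relative to a product operator. -/
lemma D_kronecker_le_chain (h0 : 0 < α) (h1 : α ≠ 1) {M : Matrix (n × m) (n × m) ℂ}
    (hM : IsState M) (hτ : τ.PosSemidef) {ω : Matrix m m ℂ} (hω : ω.PosSemidef) :
    D α M (τ ⊗ₖ ω) ≤ D α (ptB M) τ +
      D α (withMarginal (tiltState α (ptB M) τ) M) (tiltState α (ptB M) τ ⊗ₖ ω) := by
  have hR := ptB_posSemidef hM.1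
  have hν := tiltState_posSemidef (α := α) hR hτ
  have hN := withMarginal_posSemidef hν hM.1
  by_cases hD1 : D α (ptB M) τ = ⊤
  · rw [hD1, EReal.top_add_of_ne_bot (D_ne_bot _ _ _)]
    exact le_top
  by_cases hD2 : D α (withMarginal (tiltState α (ptB M) τ) M) (tiltState α (ptB M) τ ⊗ₖ ω) = ⊤
  · rw [hD2, EReal.add_top_of_ne_bot (D_ne_bot _ _ _)]
    exact le_top
  have hs : (1 - α) / (2 * α) ≠ 0 :=
    div_ne_zero (sub_ne_zero.mpr h1.symm) (by positivity)
  have htR : (ptB M).trace = 1 := by rw [trace_ptB, hM.2]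
  have hR0 : ptB M ≠ 0 := fun h => by simp [h] at htR
  have hc := trace_mpow_re_pos (sandwich_posSemidef hR hτ _) (sandwich_ne_zero_of_D_ne_top hR hτ hR0 hD1 hs) α
  have hQ1 := trace_mpow_tilt h0 h1 hR hτ
  rw [hQ1] at hc
  have htN : (withMarginal (tiltState α (ptB M) τ) M).trace = 1 := by
    rw [← trace_ptB, ptB_withMarginal_tiltState h0 hM.1 hτ, tiltState, trace_smul, smul_eq_mul,
      inv_mul_cancel₀]
    intro h
    simp [h] at hc
  have hN0 : withMarginal (tiltState α (ptB M) τ) M ≠ 0 := fun h => by simp [h] at htN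
  have hQ2 := trace_mpow_re_pos (sandwich_posSemidef hN (hν.kronecker hω) _)
    (sandwich_ne_zero_of_D_ne_top hN (hν.kronecker hω) hN0 hD2 hs) α
  have hchain := trace_mpow_chain h0 h1 hM.1 hτ hω hc
  have hD : D α M (τ ⊗ₖ ω) = (DR α M (τ ⊗ₖ ω) : ℝ) := by
    rcases lt_or_gt_of_ne h1 with hlt | hgt
    · apply D_of_sandwich_ne_zero (hτ.kronecker hω) hlt hs
      intro h
      rw [h, mpow_zero_matrix h0.ne', trace_zero, Complex.zero_re] at hchain
      exact (mul_pos hc hQ2).ne hchain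
    · exact D_of_suppSubset (suppSubset_kronecker_of_chain h0 h1 hM.1 hτ hω hc
        (suppSubset_of_D_ne_top hgt hD1) (suppSubset_of_D_ne_top hgt hD2))
  rw [hD, D_eq_DR_of_ne_top hD1, D_eq_DR_of_ne_top hD2, ← EReal.coe_add, EReal.coe_le_coe_iff]
  apply le_of_eq
  rw [DR, DR, DR, hchain, hQ1, htR, htN, hM.2, Complex.one_re, div_one, div_one, div_one,
    Real.logb_mul hc.ne' hQ2.ne', mul_add]

end TiltState

end Chain

theorem renyi_mutual_information_chain
    {A B C : Type*} [Fintype A] [DecidableEq A] [Fintype B] [DecidableEq B]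
    [Fintype C] [DecidableEq C]
    (ρ : Matrix ((A × C) × B) ((A × C) × B) ℂ) (hρ : IsState ρ)
    (σ : Matrix C C ℂ) (hσ : σ.PosSemidef)
    (ω' : Matrix A A ℂ) (hω' : IsState ω')
    (ω'' : Matrix B B ℂ) (hω'' : IsState ω'')
    (α : ℝ) (hα : α ∈ Set.Ioo (0 : ℝ) 1 ∪ Set.Ioi (1 : ℝ))
    (νAC : Matrix (A × C) (A × C) ℂ)
    (hνAC : νAC =
      ((mpow (mpow (ptB ρ) (1 / 2 : ℝ) * mpow (ω' ⊗ₖ σ) ((1 - α) / α) *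
          mpow (ptB ρ) (1 / 2 : ℝ)) α).trace)⁻¹
        • mpow (mpow (ptB ρ) (1 / 2 : ℝ) * mpow (ω' ⊗ₖ σ) ((1 - α) / α) *
            mpow (ptB ρ) (1 / 2 : ℝ)) α)
    (νABC : Matrix ((A × C) × B) ((A × C) × B) ℂ)
    (hνABC : νABC = ((mpow νAC (1 / 2 : ℝ)) ⊗ₖ (1 : Matrix B B ℂ)) *
      (((mpow (ptB ρ) (-(1 / 2) : ℝ)) ⊗ₖ (1 : Matrix B B ℂ)) * ρ *
        ((mpow (ptB ρ) (-(1 / 2) : ℝ)) ⊗ₖ (1 : Matrix B B ℂ))) *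
      ((mpow νAC (1 / 2 : ℝ)) ⊗ₖ (1 : Matrix B B ℂ))) :
    -- (i) the chain-rule inequality
    (sInf {x : EReal | ∃ ωAB : Matrix (A × B) (A × B) ℂ, IsState ωAB ∧
        x = D α ρ ((Matrix.reindex (eACB A B C) (eACB A B C)) (ωAB ⊗ₖ σ))}
      ≤ D α (ptB ρ) (ω' ⊗ₖ σ) + D α νABC (νAC ⊗ₖ ω''))
    ∧
    -- (ii) choosing `σ_C = ρ_C` and `ω'_A`, `ω''_B` as the optimizers,
    -- `I_α↓(C;AB)_ρ ≤ I_α↓(C;A)_ρ + I_α↓(AC;B)_ν`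
    (σ = ptA (ptB ρ) →
      D α ((Matrix.reindex (Equiv.prodComm A C) (Equiv.prodComm A C)) (ptB ρ))
          ((ptB ((Matrix.reindex (Equiv.prodComm A C) (Equiv.prodComm A C)) (ptB ρ))) ⊗ₖ ω')
        = Idown α ((Matrix.reindex (Equiv.prodComm A C) (Equiv.prodComm A C)) (ptB ρ)) →
      D α νABC (νAC ⊗ₖ ω'')
        = sInf {x : EReal | ∃ s : Matrix B B ℂ, IsState s ∧ x = D α νABC (νAC ⊗ₖ s)} →
      Idown α ((Matrix.reindex (eCAB A B C) (eCAB A B C)) ρ)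
        ≤ Idown α ((Matrix.reindex (Equiv.prodComm A C) (Equiv.prodComm A C)) (ptB ρ))
          + Idown α νABC) := by
  have h0 : 0 < α := by
    rcases hα with h | h
    · exact h.1
    · exact zero_lt_one.trans h
  have h1 : α ≠ 1 := by
    rcases hα with h | h
    · exact h.2.ne
    · exact ne_of_gt h
  obtain rfl : νAC = tiltState α (ptB ρ) (ω' ⊗ₖ σ) := hνAC
  obtain rfl : νABC = withMarginal (tiltState α (ptB ρ) (ω' ⊗ₖ σ)) ρ := hνABC
  have hR := ptB_posSemidef hρ.1
  have hchain : sInf {x : EReal | ∃ ωAB : Matrix (A × B) (A × B) ℂ, IsState ωAB ∧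
        x = D α ρ ((Matrix.reindex (eACB A B C) (eACB A B C)) (ωAB ⊗ₖ σ))} ≤
      D α (ptB ρ) (ω' ⊗ₖ σ) + D α (withMarginal (tiltState α (ptB ρ) (ω' ⊗ₖ σ)) ρ)
        (tiltState α (ptB ρ) (ω' ⊗ₖ σ) ⊗ₖ ω'') := by
    refine le_trans (sInf_le ⟨ω' ⊗ₖ ω'', ⟨hω'.1.kronecker hω''.1, ?_⟩, rfl⟩) ?_
    · rw [trace_kronecker, hω'.2, hω''.2, one_mul]
    · have : reindex (eACB A B C) (eACB A B C) ((ω' ⊗ₖ ω'') ⊗ₖ σ) = (ω' ⊗ₖ σ) ⊗ₖ ω'' := by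
        ext i j
        simp only [reindex_apply, submatrix_apply, kroneckerMap_apply, eACB, Equiv.coe_fn_symm_mk]
        ring
      rw [this]
      exact D_kronecker_le_chain h0 h1 hρ (hω'.1.kronecker hσ) hω''.1
  refine ⟨hchain, fun hσρ hopt' hopt'' => ?_⟩
  have hptC : ptB (reindex (Equiv.prodComm A C) (Equiv.prodComm A C) (ptB ρ)) = σ := by
    rw [hσρ]
    rfl
  have hptCAB : ptB (reindex (eCAB A B C) (eCAB A B C) ρ) = σ := by
    rw [hσρ]
    ext c c'
    simp only [ptB, ptA, of_apply, reindex_apply, submatrix_apply, eCAB, Equiv.coe_fn_symm_mk,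
      Fintype.sum_prod_type]
  have hlhs : Idown α (reindex (eCAB A B C) (eCAB A B C) ρ) ≤
      sInf {x : EReal | ∃ ωAB : Matrix (A × B) (A × B) ℂ, IsState ωAB ∧
        x = D α ρ ((Matrix.reindex (eACB A B C) (eACB A B C)) (ωAB ⊗ₖ σ))} := by
    refine le_sInf ?_
    rintro x ⟨ωAB, hωAB, rfl⟩
    refine sInf_le ⟨ωAB, hωAB, ?_⟩
    have hpsd : (reindex (eACB A B C) (eACB A B C) (ωAB ⊗ₖ σ)).PosSemidef :=
      (hωAB.1.kronecker hσ).submatrix _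
    rw [hptCAB, ← D_reindex (eCAB A B C) α hρ.1 hpsd]
    congr 1
    ext i j
    simp only [reindex_apply, submatrix_apply, kroneckerMap_apply, eACB, eCAB,
      Equiv.coe_fn_symm_mk]
    ring
  have hfst : D α (ptB ρ) (ω' ⊗ₖ σ) =
      Idown α (reindex (Equiv.prodComm A C) (Equiv.prodComm A C) (ptB ρ)) := by
    rw [← hopt', hptC, ← D_reindex (Equiv.prodComm A C) α hR (hω'.1.kronecker hσ)]
    congr 1
    ext i j
    simp only [reindex_apply, submatrix_apply, kroneckerMap_apply, Equiv.prodComm_symm,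
      Equiv.prodComm_apply, Prod.fst_swap, Prod.snd_swap]
    ring
  have hsnd : Idown α (withMarginal (tiltState α (ptB ρ) (ω' ⊗ₖ σ)) ρ) =
      D α (withMarginal (tiltState α (ptB ρ) (ω' ⊗ₖ σ)) ρ)
        (tiltState α (ptB ρ) (ω' ⊗ₖ σ) ⊗ₖ ω'') := by
    rw [hopt'', Idown, ptB_withMarginal_tiltState h0 hρ.1 (hω'.1.kronecker hσ)]
  rw [← hfst, hsnd]
  exact hlhs.trans hchain

end QITLeak
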